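/- Let F : D → E be an additive functor of exact categories and S ⊆ D a full subcategory left functorially adapted to F (closed under finite sums, admitting an S-left deformation functor, and such that in any short exact sequence 0 → X → Y → Z → 0 with Y, Z ∈ S one has X ∈ S and F preserves the exactness of this sequence). Then F sends quasi-isomorphisms between bounded-below complexes of objects of S to quasi-isomorphisms. -/

import Mathlib

open CategoryTheory Limits

universe v u

/-- A Quillen exact structure on an additive category: a class of kernel-cokernel pairs
("short exact sequences") satisfying (a selection of) Quillen's axioms. -/
structure ExactStr (C : Type u) [Category.{v} C] [Preadditive C] where
  ses : ∀ ⦃X Y Z : C⦄, (X ⟶ Y) → (Y ⟶ Z) → Prop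
  comp_zero : ∀ ⦃X Y Z : C⦄ ⦃f : X ⟶ Y⦄ ⦃g : Y ⟶ Z⦄, ses f g → f ≫ g = 0
  isKernel : ∀ ⦃X Y Z : C⦄ ⦃f : X ⟶ Y⦄ ⦃g : Y ⟶ Z⦄ (h : ses f g),
    Nonempty (IsLimit (KernelFork.ofι f (comp_zero h)))
  isCokernel : ∀ ⦃X Y Z : C⦄ ⦃f : X ⟶ Y⦄ ⦃g : Y ⟶ Z⦄ (h : ses f g),
    Nonempty (IsColimit (CokernelCofork.ofπ g (comp_zero h)))
  admMono_comp : ∀ ⦃X Y Z : C⦄ ⦃f : X ⟶ Y⦄ ⦃g : Y ⟶ Z⦄,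
    (∃ (W : C) (p : Y ⟶ W), ses f p) → (∃ (W : C) (p : Z ⟶ W), ses g p) →
    ∃ (W : C) (p : Z ⟶ W), ses (f ≫ g) p
  admEpi_comp : ∀ ⦃X Y Z : C⦄ ⦃f : X ⟶ Y⦄ ⦃g : Y ⟶ Z⦄,
    (∃ (W : C) (i : W ⟶ X), ses i f) → (∃ (W : C) (i : W ⟶ Y), ses i g) →
    ∃ (W : C) (i : W ⟶ X), ses i (f ≫ g)
  pushout_admMono : ∀ ⦃X Y X' Y' : C⦄ ⦃f : X ⟶ Y⦄ ⦃u : X ⟶ X'⦄ ⦃f' : X' ⟶ Y'⦄ ⦃u' : Y ⟶ Y'⦄,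
    IsPushout u f f' u' → (∃ (W : C) (p : Y ⟶ W), ses f p) →
    ∃ (W : C) (p : Y' ⟶ W), ses f' p
  pullback_admEpi : ∀ ⦃X Y X' Y' : C⦄ ⦃g : Y ⟶ X⦄ ⦃u : X' ⟶ X⦄ ⦃g' : Y' ⟶ X'⦄ ⦃u' : Y' ⟶ Y⦄,
    IsPullback u' g' g u → (∃ (W : C) (i : W ⟶ Y), ses i g) →
    ∃ (W : C) (i : W ⟶ Y'), ses i g'

namespace ExactStr

variable {C : Type u} [Category.{v} C] [Preadditive C] (E : ExactStr C)

/-- Admissible monomorphisms. -/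
def AdmMono {X Y : C} (f : X ⟶ Y) : Prop := ∃ (W : C) (p : Y ⟶ W), E.ses f p

/-- Admissible epimorphisms. -/
def AdmEpi {Y Z : C} (g : Y ⟶ Z) : Prop := ∃ (W : C) (i : W ⟶ Y), E.ses i g

/-- Weak idempotent completeness: every split monomorphism is admissible. -/
def WIC : Prop :=
  ∀ ⦃X Y : C⦄ (f : X ⟶ Y) (r : Y ⟶ X), f ≫ r = 𝟙 X → E.AdmMono f

/-- A (ℤ-indexed, homologically graded) chain complex is acyclic for the exact structure `E`
if each differential factors as an admissible epi onto `Z (n-1)` followed by an admissible mono,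
with the resulting sequences `0 → Z n → Xₙ → Z (n-1) → 0` short exact. -/
def Acyclic (X : ChainComplex C ℤ) : Prop :=
  ∃ (Z : ℤ → C) (i : ∀ n, Z n ⟶ X.X n) (p : ∀ n, X.X n ⟶ Z (n - 1)),
    (∀ n, X.d n (n - 1) = p n ≫ i (n - 1)) ∧ (∀ n, E.ses (i n) (p n))

/-- Quasi-isomorphisms of complexes in an exact category: chain maps whose
mapping cone is acyclic. -/
def QIso [HasBinaryBiproducts C] {X Y : ChainComplex C ℤ} (f : X ⟶ Y) : Prop :=
  haveI : HomologicalComplex.HasHomotopyCofiber f := ⟨fun _ _ _ => inferInstance⟩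
  E.Acyclic (HomologicalComplex.homotopyCofiber f)

end ExactStr


namespace ExactStr

variable {C : Type u} [Category.{v} C] [Preadditive C] (E : ExactStr C)

/-- A pair isomorphic to a short exact sequence. -/
def WSes {X Y Z : C} (f : X ⟶ Y) (g : Y ⟶ Z) : Prop :=
  ∃ (X' Y' Z' : C) (f' : X' ⟶ Y') (g' : Y' ⟶ Z') (a : X' ≅ X) (b : Y' ≅ Y) (c : Z' ≅ Z),
    E.ses f' g' ∧ f' ≫ b.hom = a.hom ≫ f ∧ g' ≫ c.hom = b.hom ≫ g

variable {E}

theorem WSes.of_ses {X Y Z : C} {f : X ⟶ Y} {g : Y ⟶ Z} (h : E.ses f g) : E.WSes f g :=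
  ⟨X, Y, Z, f, g, Iso.refl _, Iso.refl _, Iso.refl _, h, by simp, by simp⟩

theorem WSes.transport {X Y Z X' Y' Z' : C} {f : X ⟶ Y} {g : Y ⟶ Z} {f' : X' ⟶ Y'}
    {g' : Y' ⟶ Z'} (h : E.WSes f g) (a : X ≅ X') (b : Y ≅ Y') (c : Z ≅ Z')
    (h1 : f ≫ b.hom = a.hom ≫ f') (h2 : g ≫ c.hom = b.hom ≫ g') : E.WSes f' g' := by
  obtain ⟨A, B, D, k, l, α, β, γ, hs, e1, e2⟩ := h
  refine ⟨A, B, D, k, l, α ≪≫ a, β ≪≫ b, γ ≪≫ c, hs, ?_, ?_⟩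
  · simp [reassoc_of% e1, h1]
  · simp [reassoc_of% e2, h2]

theorem ses_mono {X Y Z : C} {f : X ⟶ Y} {g : Y ⟶ Z} (h : E.ses f g) : Mono f := by
  obtain ⟨hl⟩ := E.isKernel h
  exact ⟨fun u w e => Fork.IsLimit.hom_ext hl e⟩

theorem ses_epi {X Y Z : C} {f : X ⟶ Y} {g : Y ⟶ Z} (h : E.ses f g) : Epi g := by
  obtain ⟨hl⟩ := E.isCokernel h
  exact ⟨fun u w e => Cofork.IsColimit.hom_ext hl e⟩

theorem ses_lift {X Y Z : C} {f : X ⟶ Y} {g : Y ⟶ Z} (h : E.ses f g) {W : C} (k : W ⟶ Y)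
    (hk : k ≫ g = 0) : ∃ l : W ⟶ X, l ≫ f = k := by
  obtain ⟨hl⟩ := E.isKernel h
  obtain ⟨l, e⟩ := KernelFork.IsLimit.lift' hl k hk
  exact ⟨l, e⟩

theorem ses_desc {X Y Z : C} {f : X ⟶ Y} {g : Y ⟶ Z} (h : E.ses f g) {W : C} (k : Y ⟶ W)
    (hk : f ≫ k = 0) : ∃ l : Z ⟶ W, g ≫ l = k := by
  obtain ⟨hl⟩ := E.isCokernel h
  obtain ⟨l, e⟩ := CokernelCofork.IsColimit.desc' hl k hk
  exact ⟨l, e⟩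

/-- Fixing the middle and right hand objects, one may choose the kernel. -/
theorem WSes.up {X Y Z : C} {f : X ⟶ Y} {g : Y ⟶ Z} (h : E.WSes f g) :
    ∃ (X' : C) (a : X' ≅ X), E.ses (a.hom ≫ f) g := by
  obtain ⟨A, B, D, k, l, α, β, γ, hs, e1, e2⟩ := h
  have sq : IsPullback β.inv g l γ.inv := by
    apply IsPullback.of_horiz_isIso
    constructor
    rw [← cancel_mono γ.hom]
    simp [e2]
  obtain ⟨K, i, hi⟩ := E.pullback_admEpi sq ⟨_, _, hs⟩
  have hfg : f ≫ g = 0 := by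
    have h0 := E.comp_zero hs
    rw [← cancel_epi α.hom, ← reassoc_of% e1, ← e2, reassoc_of% h0]
    simp
  have := ses_mono hi
  have := ses_mono hs
  obtain ⟨u, hu⟩ := ses_lift hi f hfg
  obtain ⟨w, hw⟩ := ses_lift hs (i ≫ β.inv) (by
    rw [← cancel_mono γ.hom]
    simp [e2, E.comp_zero hi])
  have key : w ≫ α.hom ≫ f = i := by
    rw [← e1, reassoc_of% hw]; simp
  have hf : Mono f := by
    have : f = α.inv ≫ k ≫ β.hom := by simp [e1]
    rw [this]; infer_instance
  refine ⟨K, ⟨w ≫ α.hom, u, ?_, ?_⟩, ?_⟩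
  · rw [← cancel_mono i]; simp [hu, key]
  · rw [← cancel_mono f]; simp [key, hu]
  · simpa [key] using hi

/-- Fixing the middle and left hand objects, one may choose the cokernel. -/
theorem WSes.down {X Y Z : C} {f : X ⟶ Y} {g : Y ⟶ Z} (h : E.WSes f g) :
    ∃ (Z' : C) (c : Z ≅ Z'), E.ses f (g ≫ c.hom) := by
  obtain ⟨A, B, D, k, l, α, β, γ, hs, e1, e2⟩ := h
  have sq : IsPushout α.hom k f β.hom := by
    apply IsPushout.of_horiz_isIso
    exact ⟨e1.symm⟩
  obtain ⟨K, i, hi⟩ := E.pushout_admMono sq ⟨_, _, hs⟩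
  have hfg : f ≫ g = 0 := by
    have h0 := E.comp_zero hs
    rw [← cancel_epi α.hom, ← reassoc_of% e1, ← e2, reassoc_of% h0]
    simp
  have := ses_epi hi
  have := ses_epi hs
  obtain ⟨u, hu⟩ := ses_desc hi g hfg
  obtain ⟨w, hw⟩ := ses_desc hs (β.hom ≫ i) (by
    rw [reassoc_of% e1]
    simp [E.comp_zero hi])
  have hg' : g = β.inv ≫ l ≫ γ.hom := by simp [e2]
  have key : g ≫ γ.inv ≫ w = i := by
    rw [hg']; simp [hw]
  have hg : Epi g := by
    rw [hg']; infer_instance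
  refine ⟨K, ⟨γ.inv ≫ w, u, ?_, ?_⟩, ?_⟩
  · rw [← cancel_epi g]; simp [hu, reassoc_of% key]
  · rw [← cancel_epi i]; simp [key, reassoc_of% hu]
  · simpa [key] using hi

end ExactStr

/-- Two-sided dependent choice along the integers. -/
theorem int_section (W : ℤ → Type*) (R : ∀ m n : ℤ, m = n - 1 → W m → W n → Prop)
    (w0 : W 0) (up : ∀ m n h (w : W m), ∃ w', R m n h w w')
    (dn : ∀ m n h (w : W n), ∃ w', R m n h w' w) :
    ∃ w : ∀ n, W n, ∀ m n h, R m n h (w m) (w n) := by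
  choose U hU using up
  choose V hV using dn
  let P : ∀ k : ℕ, W (Int.ofNat k) := fun k =>
    Nat.rec (motive := fun k => W (Int.ofNat k)) w0
      (fun k w => U (Int.ofNat k) (Int.ofNat (k + 1)) (by simp) w) k
  let M : ∀ k : ℕ, W (Int.negSucc k) := fun k =>
    Nat.rec (motive := fun k => W (Int.negSucc k)) (V (Int.negSucc 0) 0 (by simp) w0)
      (fun k w => V (Int.negSucc (k + 1)) (Int.negSucc k) (by omega) w) k
  let w : ∀ n, W n := fun n => match n with
    | Int.ofNat k => P k
    | Int.negSucc k => M k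
  refine ⟨w, ?_⟩
  intro m n h
  rcases m with k | k
  · obtain rfl : n = Int.ofNat (k + 1) := by simp at *; omega
    exact hU _ _ _ _
  · rcases k with _ | k
    · obtain rfl : n = Int.ofNat 0 := by simp at *; omega
      exact hV _ _ _ _
    · obtain rfl : n = Int.negSucc k := by omega
      exact hV _ _ _ _

/-- A complex isomorphic to one which is acyclic up to isomorphism is acyclic. -/
theorem acyclic_of_wses {C : Type u} [Category.{v} C] [Preadditive C] (E : ExactStr C)
    (X : ChainComplex C ℤ) (Z : ℤ → C) (i : ∀ n, Z n ⟶ X.X n) (p : ∀ n, X.X n ⟶ Z (n - 1))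
    (hd : ∀ n, X.d n (n - 1) = p n ≫ i (n - 1)) (hs : ∀ n, E.WSes (i n) (p n)) :
    E.Acyclic X := by
  obtain ⟨w, hw⟩ := int_section (fun n => Σ B : C, B ≅ Z n)
    (fun m n h w w' => E.ses (w'.2.hom ≫ i n) (p n ≫ eqToHom (by rw [h]) ≫ w.2.inv))
    ⟨_, Iso.refl _⟩
    (by
      rintro m n rfl ⟨B, b⟩
      obtain ⟨A, a, h⟩ := ((hs n).transport (Iso.refl _) (Iso.refl _) b.symm
        (f' := i n) (g' := p n ≫ b.inv) (by simp) (by simp)).up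
      exact ⟨⟨A, a⟩, by simpa using h⟩)
    (by
      rintro m n rfl ⟨B, b⟩
      obtain ⟨A, a, h⟩ := ((hs n).transport b.symm (Iso.refl _) (Iso.refl _)
        (f' := b.hom ≫ i n) (g' := p n) (by simp) (by simp)).down
      exact ⟨⟨A, a.symm⟩, by simpa using h⟩)
  refine ⟨fun n => (w n).1, fun n => (w n).2.hom ≫ i n, fun n => p n ≫ (w (n - 1)).2.inv, ?_, ?_⟩
  · intro n; simp [hd]
  · intro n; simpa using hw (n - 1) n rfl

theorem acyclic_of_iso {C : Type u} [Category.{v} C] [Preadditive C] (E : ExactStr C)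
    {X' X : ChainComplex C ℤ} (e : X' ≅ X)
    (Z : ℤ → C) (i : ∀ n, Z n ⟶ X'.X n) (p : ∀ n, X'.X n ⟶ Z (n - 1))
    (hd : ∀ n, X'.d n (n - 1) = p n ≫ i (n - 1)) (hs : ∀ n, E.WSes (i n) (p n)) :
    E.Acyclic X := by
  have h3 : ∀ n, e.inv.f n ≫ e.hom.f n = 𝟙 _ := fun n => by
    rw [← HomologicalComplex.comp_f]; simp
  have h4 : ∀ n, e.hom.f n ≫ e.inv.f n = 𝟙 _ := fun n => by
    rw [← HomologicalComplex.comp_f]; simp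
  refine acyclic_of_wses E _ Z (fun n => i n ≫ e.hom.f n) (fun n => e.inv.f n ≫ p n) ?_ ?_
  · intro n
    have h1 := e.inv.comm n (n - 1)
    have h2 := hd n
    rw [Category.assoc, ← reassoc_of% h2, reassoc_of% h1, h3, Category.comp_id]
  · intro n
    refine (hs n).transport (Iso.refl _) ⟨e.hom.f n, e.inv.f n, h4 n, h3 n⟩ (Iso.refl _) ?_ ?_
    · simp
    · simp [reassoc_of% (h4 n)]

/-- Let `F : D ⥤ E` be an additive functor of exact categories and
`S ⊆ D` a full subcategory which is left functorially adapted to `F`. Then `F` sends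
quasi-isomorphisms between bounded-below complexes of objects of `S` to quasi-isomorphisms. -/
theorem adapted_preserves_qiso
    {D : Type u} [Category.{v} D] [Preadditive D] [HasBinaryBiproducts D]
    {E : Type u} [Category.{v} E] [Preadditive E] [HasBinaryBiproducts E]
    (ExD : ExactStr D) (ExE : ExactStr E)
    (F : D ⥤ E) [F.Additive]
    (S : Set D)
    -- `S` is closed under finite direct sums:
    (hsum : ∀ X ∈ S, ∀ Y ∈ S, (X ⊞ Y) ∈ S)
    -- there is an `S`-left deformation functor:
    (Q : D ⥤ D) (η : Q ⟶ 𝟭 D)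
    (hQS : ∀ X : D, Q.obj X ∈ S)
    (hη : ∀ X : D, ExD.AdmEpi (η.app X))
    -- two-out-of-three and `F`-exactness for short exact sequences ending in `S`:
    (hadapt : ∀ ⦃X Y Z : D⦄ (f : X ⟶ Y) (g : Y ⟶ Z), ExD.ses f g →
      Y ∈ S → Z ∈ S → X ∈ S ∧ ExE.ses (F.map f) (F.map g))
    -- a quasi-isomorphism of bounded-below complexes of objects of `S`:
    {X Y : ChainComplex D ℤ} (f : X ⟶ Y)
    (hXS : ∀ n : ℤ, X.X n ∈ S ∨ IsZero (X.X n))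
    (hYS : ∀ n : ℤ, Y.X n ∈ S ∨ IsZero (Y.X n))
    (hXb : ∃ N : ℤ, ∀ n : ℤ, n < N → IsZero (X.X n))
    (hYb : ∃ N : ℤ, ∀ n : ℤ, n < N → IsZero (Y.X n))
    (hf : ExD.QIso f) :
    ExE.QIso ((F.mapHomologicalComplex (ComplexShape.down ℤ)).map f) := by
  obtain ⟨Z, i, p, hd, hs⟩ := hf
  haveI : HomologicalComplex.HasHomotopyCofiber f := ⟨fun _ _ _ => inferInstance⟩
  let e := HomologicalComplex.homotopyCofiber.mapHomologicalComplexObjIso f F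
  obtain ⟨Nx, hNx⟩ := hXb
  obtain ⟨Ny, hNy⟩ := hYb
  have rel : ∀ n : ℤ, (ComplexShape.down ℤ).Rel n (n - 1) := fun n => by simp
  have hC0 : ∀ n, n < min Nx Ny → IsZero ((HomologicalComplex.homotopyCofiber f).X n) := by
    intro n hn
    refine HomologicalComplex.homotopyCofiber.isZero_X f n ?_ ?_
    · exact hNy n (by omega)
    · intro j hj
      simp at hj
      exact hNx j (by omega)
  have hZ0 : ∀ n, n < min Nx Ny → IsZero (Z n) := by
    intro n hn
    have := ExactStr.ses_mono (hs n)
    exact IsZero.of_mono (i n) (hC0 n hn)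
  -- a zero object in `S`
  obtain ⟨K, hKS, hK0⟩ : ∃ K ∈ S, IsZero K := by
    let n := min Nx Ny - 1
    have z1 := hC0 n (by omega)
    have z2 := hZ0 (n - 1) (by omega)
    have sq : IsPullback (0 : Q.obj (Z n) ⟶ _) (𝟙 (Q.obj (Z n))) (p n) 0 := by
      have : IsIso (p n) := ⟨0, z1.eq_of_src _ _, z2.eq_of_src _ _⟩
      exact IsPullback.of_vert_isIso ⟨z2.eq_of_tgt _ _⟩
    obtain ⟨K, k, hk⟩ := ExD.pullback_admEpi sq ⟨_, _, hs n⟩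
    refine ⟨K, (hadapt _ _ hk (hQS _) (hQS _)).1, ?_⟩
    have := ExactStr.ses_mono hk
    have hz := ExD.comp_zero hk
    simp only [Category.comp_id] at hz
    rw [IsZero.iff_id_eq_zero, ← cancel_mono k, hz]
    simp
  have hS' : ∀ A, (A ∈ S ∨ IsZero A) → ∃ T ∈ S, Nonempty (T ≅ A) := by
    rintro A (h | h)
    · exact ⟨A, h, ⟨Iso.refl _⟩⟩
    · exact ⟨K, hKS, ⟨hK0.iso h⟩⟩
  have hT : ∀ n, ∃ T ∈ S, Nonempty (T ≅ (HomologicalComplex.homotopyCofiber f).X n) := by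
    intro n
    obtain ⟨T1, h1, ⟨e1⟩⟩ := hS' _ (hXS (n - 1))
    obtain ⟨T2, h2, ⟨e2⟩⟩ := hS' _ (hYS n)
    exact ⟨T1 ⊞ T2, hsum _ h1 _ h2, ⟨biprod.mapIso e1 e2 ≪≫
      (HomologicalComplex.homotopyCofiber.XIsoBiprod f n (n - 1) (rel n)).symm⟩⟩
  have step : ∀ n, (∃ A ∈ S, Nonempty (A ≅ Z (n - 1))) →
      (∃ A ∈ S, Nonempty (A ≅ Z n)) ∧ ExE.WSes (F.map (i n)) (F.map (p n)) := by
    rintro n ⟨A, hA, ⟨a⟩⟩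
    obtain ⟨T, hTS, ⟨t⟩⟩ := hT n
    obtain ⟨B, b, hB⟩ := ((ExactStr.WSes.of_ses (hs n)).transport (Iso.refl _) t.symm a.symm
      (f' := i n ≫ t.inv) (g' := t.hom ≫ p n ≫ a.inv) (by simp) (by simp)).up
    obtain ⟨hBS, hF⟩ := hadapt _ _ hB hTS hA
    refine ⟨⟨B, hBS, ⟨b⟩⟩, (ExactStr.WSes.of_ses hF).transport (F.mapIso b) (F.mapIso t)
      (F.mapIso a) ?_ ?_⟩
    · rw [Functor.mapIso_hom, Functor.mapIso_hom, ← F.map_comp, ← F.map_comp]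
      simp
    · rw [Functor.mapIso_hom, Functor.mapIso_hom, ← F.map_comp, ← F.map_comp]
      simp
  have hP : ∀ n, ∃ A ∈ S, Nonempty (A ≅ Z n) := by
    have low : ∀ n, n < min Nx Ny → ∃ A ∈ S, Nonempty (A ≅ Z n) := fun n hn =>
      ⟨K, hKS, ⟨hK0.iso (hZ0 n hn)⟩⟩
    intro n
    by_cases hn : n < min Nx Ny
    · exact low n hn
    · have hn' : min Nx Ny - 1 ≤ n := by omega
      induction n, hn' using Int.leInduction with
      | base => exact low _ (by omega)
      | succ n hmn ih =>
        apply (step (n + 1) _).1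
        rw [add_sub_cancel_right]
        by_cases h : n < min Nx Ny
        · exact low n h
        · exact ih h
  have hW : ∀ n, ExE.WSes (F.map (i n)) (F.map (p n)) := fun n => (step n (hP _)).2
  refine acyclic_of_iso ExE e (fun n => F.obj (Z n)) (fun n => F.map (i n))
    (fun n => F.map (p n)) ?_ hW
  intro n
  exact (congrArg F.map (hd n)).trans (F.map_comp _ _)
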